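/- arXiv:2409.14641 — 2 statements merged into one kernel-verified Lean document; each statement's English description precedes it below -/
import Mathlib

section
/- Let m ≥ 2 be an integer and suppose η_i = 0 for all i ∈ J_{κ−1}, so that branches are attached only at the vertex x_κ. Then the composition operator C on L²(μ) is m-isometric if and only if both of the following hold: (a) for every i ∈ J_{η_κ} the sequence (μ({x^κ_{i,j+1}}))_{j∈ℤ₊} is a polynomial in j of degree at most m−2; (b) ∑_{p=0}^{m} (−1)^p binom(m,p) h_p(x_r) = 0 for every r ∈ J_κ. -/
open MeasureTheory Finset

noncomputable section

/-- A real sequence indexed by the nonnegative integers is a polynomial in `n` of degree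
at most `d` if some real polynomial of degree at most `d` interpolates it. -/
def IsPolySeq (d : ℕ) (γ : ℕ → ℝ) : Prop :=
  ∃ q : Polynomial ℝ, q.natDegree ≤ d ∧ ∀ n : ℕ, q.eval (n : ℝ) = γ n

/-- `B_m(T) = ∑_{j=0}^m (-1)^j C(m,j) T*^{m-j} T^{m-j}`. -/
def BmOp {H : Type*} [NormedAddCommGroup H] [InnerProductSpace ℂ H] [CompleteSpace H]
    (m : ℕ) (T : H →L[ℂ] H) : H →L[ℂ] H :=
  ∑ j ∈ Finset.range (m + 1), ((-1 : ℂ) ^ j * (m.choose j : ℂ)) •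
    ((ContinuousLinearMap.adjoint T) ^ (m - j) * T ^ (m - j))

/-- `T` is a `k`-quasi-`m`-isometry, i.e. `T*^k B_m(T) T^k = 0`. -/
def IsQuasiIso {H : Type*} [NormedAddCommGroup H] [InnerProductSpace ℂ H] [CompleteSpace H]
    (k m : ℕ) (T : H →L[ℂ] H) : Prop :=
  (ContinuousLinearMap.adjoint T) ^ k * BmOp m T * T ^ k = 0

/-- The Radon–Nikodym derivative `h_p` of `μ ∘ φ^{-p}` with respect to `μ` in the discrete
setting: `h_p(x) = μ(φ^{-p}({x}))/μ({x})`. -/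
def hRN {X : Type*} [MeasurableSpace X] (μ : Measure X) (φ : X → X) (p : ℕ) (x : X) : ℝ :=
  (μ ((φ^[p]) ⁻¹' {x})).toReal / (μ {x}).toReal

/-- alternating binomial sum -/
def altSum (m : ℕ) (a : ℕ → ℝ) : ℝ :=
  ∑ p ∈ Finset.range (m + 1), (-1 : ℝ) ^ p * (m.choose p : ℝ) * a p

lemma altSum_eq_fwd (m : ℕ) (a : ℕ → ℝ) (n : ℕ) :
    (fwdDiff 1)^[m] a n = (-1) ^ m * altSum m (fun p => a (n + p)) := by
  rw [fwdDiff_iter_eq_sum_shift, altSum, Finset.mul_sum]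
  refine Finset.sum_congr rfl fun p hp => ?_
  have hp' : p ≤ m := by simpa [Nat.lt_succ_iff] using hp
  obtain ⟨k, rfl⟩ := Nat.exists_eq_add_of_le hp'
  simp only [Nat.add_sub_cancel_left, zsmul_eq_mul, smul_eq_mul, mul_one]
  push_cast
  have : (-1 : ℝ) ^ (p + k) * (-1) ^ p = (-1) ^ k := by
    rw [pow_add, mul_right_comm, ← mul_pow]; simp
  rw [← this]; ring

lemma poly_of_altSum (m : ℕ) (hm : 1 ≤ m) (a : ℕ → ℝ)
    (h : ∀ n, altSum m (fun p => a (n + p)) = 0) : IsPolySeq (m - 1) a := by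
  have h0 : (fwdDiff 1)^[m] a = 0 := by
    funext n; rw [altSum_eq_fwd, h]; simp
  have hk : ∀ k, m ≤ k → (fwdDiff 1)^[k] a 0 = 0 := by
    intro k hk
    obtain ⟨l, rfl⟩ := Nat.exists_eq_add_of_le hk
    rw [add_comm, Function.iterate_add_apply, h0]
    rw [altSum_eq_fwd]; simp [altSum]
  refine ⟨∑ k ∈ Finset.range m, Polynomial.C ((fwdDiff 1)^[k] a 0 / (k.factorial : ℝ)) *
    descPochhammer ℝ k, ?_, ?_⟩
  · refine Polynomial.natDegree_sum_le_of_forall_le _ _ fun k hk => ?_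
    refine (Polynomial.natDegree_C_mul_le _ _).trans ?_
    rw [descPochhammer_natDegree]
    have := Finset.mem_range.1 hk
    omega
  · intro n
    have := shift_eq_sum_fwdDiff_iter (h := 1) a n 0
    simp only [smul_eq_mul, mul_one, zero_add] at this
    rw [this, Polynomial.eval_finset_sum]
    have e1 : ∑ k ∈ Finset.range m, Polynomial.eval (n : ℝ)
        (Polynomial.C ((fwdDiff 1)^[k] a 0 / (k.factorial : ℝ)) * descPochhammer ℝ k)
        = ∑ k ∈ Finset.range m, n.choose k • (fwdDiff 1)^[k] a 0 := by
      refine Finset.sum_congr rfl fun k _ => ?_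
      rw [Polynomial.eval_mul, Polynomial.eval_C, descPochhammer_eval_eq_descFactorial,
        Nat.descFactorial_eq_factorial_mul_choose]
      have : (k.factorial : ℝ) ≠ 0 := by positivity
      push_cast
      rw [nsmul_eq_mul]
      field_simp
    rw [e1]
    have e3 : ∀ N, (∀ k, N ≤ k → n.choose k • (fwdDiff 1)^[k] a 0 = 0) → ∀ M, N ≤ M →
        ∑ k ∈ Finset.range N, n.choose k • (fwdDiff 1)^[k] a 0
        = ∑ k ∈ Finset.range M, n.choose k • (fwdDiff 1)^[k] a 0 := by
      intro N hN M hM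
      refine Finset.sum_subset (fun x hx => ?_) (fun k _ hk => hN k ?_)
      · simp at hx ⊢; omega
      · simpa using hk
    rw [e3 m (fun k h => by rw [hk k h]; simp) (max m (n+1)) (le_max_left _ _),
      e3 (n+1) (fun k h => by rw [Nat.choose_eq_zero_of_lt (by omega)]; simp)
        (max m (n+1)) (le_max_right _ _)]

lemma altSum_of_poly (m d : ℕ) (hd : d < m) (a : ℕ → ℝ) (h : IsPolySeq d a) (n : ℕ) :
    altSum m (fun p => a (n + p)) = 0 := by
  obtain ⟨q, hq, hqa⟩ := h
  have := congrFun (Polynomial.fwdDiff_iter_eq_zero_of_degree_lt (P := q) (n := m) (by omega)) (n : ℝ)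
  have h2 : (fwdDiff 1)^[m] (q.eval) (n : ℝ) = (fwdDiff 1)^[m] a n := by
    rw [fwdDiff_iter_eq_sum_shift, fwdDiff_iter_eq_sum_shift]
    refine Finset.sum_congr rfl fun p _ => ?_
    rw [← hqa]; simp
  rw [h2, altSum_eq_fwd] at this
  simpa using this

lemma poly_bound (m κ : ℕ) (hm : 2 ≤ m) (hκ : 1 ≤ κ) (a g : ℕ → ℝ)
    (ha : IsPolySeq (m - 1) a) (hg : IsPolySeq (m - 1) g) (hpos : ∀ n, 0 < g n)
    (hle : ∀ p, a p + g (p + (κ - 1)) ≤ a (p + κ)) : IsPolySeq (m - 2) g := by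
  obtain ⟨q, hq, hqa⟩ := ha
  obtain ⟨r, hr, hrg⟩ := hg
  refine ⟨r, ?_, hrg⟩
  set s := Polynomial.taylor (κ : ℝ) q - q with hs
  have hsd : s.natDegree ≤ m - 2 := by
    by_cases hq0 : q = 0
    · simp [hs, hq0]
    by_cases hs0 : s = 0
    · simp [hs0]
    have := Polynomial.degree_sub_lt_right (p := Polynomial.taylor (κ : ℝ) q) (q := q)
      (by simp) hq0 (by simp)
    have := Polynomial.natDegree_lt_natDegree hs0 this
    omega
  set t := Polynomial.taylor ((κ - 1 : ℕ) : ℝ) r with ht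
  have htd : t.natDegree = r.natDegree := Polynomial.natDegree_taylor _ _
  have ht' : ∀ p : ℕ, t.eval (p : ℝ) = g (p + (κ - 1)) := by
    intro p; rw [ht, Polynomial.taylor_eval, ← hrg]; push_cast; ring_nf
  have hs' : ∀ p : ℕ, s.eval (p : ℝ) = a (p + κ) - a p := by
    intro p; rw [hs, Polynomial.eval_sub, Polynomial.taylor_eval, ← hqa, ← hqa]; push_cast; ring_nf
  by_contra hcon
  have hlt : s.degree < t.degree := Polynomial.degree_lt_degree (by omega)
  have hT := (Polynomial.div_tendsto_zero_of_degree_lt s t hlt).comp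
    (tendsto_natCast_atTop_atTop (R := ℝ))
  have : (1 : ℝ) ≤ 0 := by
    refine ge_of_tendsto' hT fun p => ?_
    simp only [Function.comp]
    have h1 : 0 < t.eval (p : ℝ) := by rw [ht']; exact hpos _
    rw [le_div_iff₀ h1, one_mul, ht', hs']
    linarith [hle p]
  linarith

open ComplexConjugate in
lemma inner_BmOp {H : Type*} [NormedAddCommGroup H] [InnerProductSpace ℂ H] [CompleteSpace H]
    (m : ℕ) (T : H →L[ℂ] H) (f : H) :
    inner ℂ (BmOp m T f) f = (((-1) ^ m * altSum m (fun p => ‖(T ^ p) f‖ ^ 2) : ℝ) : ℂ) := by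
  have key : ∀ p, inner ℂ (((ContinuousLinearMap.adjoint T) ^ p * T ^ p) f) f
      = ((‖(T ^ p) f‖ ^ 2 : ℝ) : ℂ) := by
    intro p
    have : (ContinuousLinearMap.adjoint T) ^ p = ContinuousLinearMap.adjoint (T ^ p) := by
      rw [← ContinuousLinearMap.star_eq_adjoint, ← ContinuousLinearMap.star_eq_adjoint, star_pow]
    rw [this, ContinuousLinearMap.mul_apply, ContinuousLinearMap.adjoint_inner_left,
      inner_self_eq_norm_sq_to_K]
    simp
  rw [BmOp, ContinuousLinearMap.sum_apply, sum_inner, ← Finset.sum_range_reflect, altSum,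
    Finset.mul_sum]
  rw [Complex.ofReal_sum]
  refine Finset.sum_congr rfl fun p hp => ?_
  have hp' : p ≤ m := by simpa [Nat.lt_succ_iff] using hp
  have e : m - (m + 1 - 1 - p) = p := by omega
  have e' : m + 1 - 1 - p = m - p := by omega
  rw [e, e', ContinuousLinearMap.smul_apply, inner_smul_left, key, Nat.choose_symm hp']
  simp only [map_mul, map_pow, map_neg, map_one, map_natCast]
  obtain ⟨k, rfl⟩ := Nat.exists_eq_add_of_le hp'
  have : (-1 : ℂ) ^ (p + k) * (-1) ^ p = (-1) ^ k := by
    rw [pow_add, mul_right_comm, ← mul_pow]; simp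
  simp only [Nat.add_sub_cancel_left]
  push_cast
  rw [← this]; ring

lemma BmOp_zero_iff {H : Type*} [NormedAddCommGroup H] [InnerProductSpace ℂ H] [CompleteSpace H]
    (m : ℕ) (T : H →L[ℂ] H) :
    BmOp m T = 0 ↔ ∀ f, altSum m (fun p => ‖(T ^ p) f‖ ^ 2) = 0 := by
  constructor
  · intro h f
    have := inner_BmOp m T f
    rw [h, ContinuousLinearMap.zero_apply, inner_zero_left] at this
    have := Complex.ofReal_eq_zero.1 this.symm
    simpa using this
  · intro h
    have := (inner_map_self_eq_zero (BmOp m T : H →ₗ[ℂ] H)).1 (fun f => by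
      have := inner_BmOp m T f
      rw [h] at this
      simpa using this)
    ext f
    exact LinearMap.congr_fun this f

section meas
variable {X : Type*} [MeasurableSpace X] [Countable X]

lemma enorm_C_pow (hmeas : ∀ s : Set X, MeasurableSet s) (φ : X → X) (μ : Measure X)
    (hμ : ∀ x : X, 0 < μ {x} ∧ μ {x} < ⊤)
    (C : Lp ℂ 2 μ →L[ℂ] Lp ℂ 2 μ)
    (hC : ∀ f : Lp ℂ 2 μ, (C f : X → ℂ) =ᵐ[μ] fun x => f (φ x)) (p : ℕ) (f : Lp ℂ 2 μ) :
    ‖(C ^ p) f‖ₑ ^ 2 = ∑' x, ‖f x‖ₑ ^ 2 * μ ((φ^[p]) ⁻¹' {x}) := by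
  haveI : MeasurableSingletonClass X := ⟨fun _ => hmeas _⟩
  have hae : ∀ P : X → Prop, (∀ᵐ x ∂μ, P x) → ∀ x, P x := by
    intro P hP x
    by_contra hx
    have : μ {x} ≤ μ {y | ¬ P y} := measure_mono (by simpa using hx)
    rw [ae_iff.1 hP] at this
    exact absurd (hμ x).1 (not_lt.2 this)
  have hC' : ∀ f : Lp ℂ 2 μ, ∀ x, (C f : X → ℂ) x = f (φ x) := fun f => hae _ (hC f)
  have hp : ∀ p x, ((C ^ p) f : Lp ℂ 2 μ) x = f (φ^[p] x) := by
    intro p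
    induction p with
    | zero => intro x; simp
    | succ p ih =>
      intro x
      rw [pow_succ', ContinuousLinearMap.mul_apply, hC', ih, Function.iterate_succ_apply]
  have h1 : ‖(C ^ p) f‖ₑ ^ 2 = ∫⁻ x, ‖f (φ^[p] x)‖ₑ ^ 2 ∂μ := by
    have := eLpNorm_nnreal_pow_eq_lintegral (μ := μ) (f := ((C ^ p) f : Lp ℂ 2 μ)) (p := 2)
      (by norm_num)
    rw [Lp.enorm_def]
    simp only [hp] at this
    simpa using this
  have hφ : Measurable (φ^[p]) := fun s _ => hmeas _
  rw [h1, ← lintegral_map (f := fun x => ‖f x‖ₑ ^ 2) (fun s _ => hmeas _) hφ,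
    lintegral_countable']
  refine tsum_congr fun x => ?_
  rw [Measure.map_apply hφ (hmeas _)]

lemma norm_C_pow (hmeas : ∀ s : Set X, MeasurableSet s) (φ : X → X) (μ : Measure X)
    (hμ : ∀ x : X, 0 < μ {x} ∧ μ {x} < ⊤)
    (C : Lp ℂ 2 μ →L[ℂ] Lp ℂ 2 μ)
    (hC : ∀ f : Lp ℂ 2 μ, (C f : X → ℂ) =ᵐ[μ] fun x => f (φ x)) (p : ℕ) (f : Lp ℂ 2 μ) :
    HasSum (fun x => ‖f x‖ ^ 2 * (μ ((φ^[p]) ⁻¹' {x})).toReal) (‖(C ^ p) f‖ ^ 2) := by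
  have h := enorm_C_pow hmeas φ μ hμ C hC p f
  have hne : ∑' x, ‖f x‖ₑ ^ 2 * μ ((φ^[p]) ⁻¹' {x}) ≠ ⊤ := by
    rw [← h]; simp
  have := ENNReal.hasSum_toReal hne
  rw [← ENNReal.tsum_toReal_eq (fun x => ENNReal.ne_top_of_tsum_ne_top hne x), ← h] at this
  simpa using this

lemma norm_C_pow_single (hmeas : ∀ s : Set X, MeasurableSet s) (φ : X → X) (μ : Measure X)
    (hμ : ∀ x : X, 0 < μ {x} ∧ μ {x} < ⊤)
    (C : Lp ℂ 2 μ →L[ℂ] Lp ℂ 2 μ)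
    (hC : ∀ f : Lp ℂ 2 μ, (C f : X → ℂ) =ᵐ[μ] fun x => f (φ x)) (x : X) :
    ∃ f : Lp ℂ 2 μ, ∀ p, ‖(C ^ p) f‖ₑ ^ 2 = μ ((φ^[p]) ⁻¹' {x}) := by
  haveI : MeasurableSingletonClass X := ⟨fun _ => hmeas _⟩
  have hae : ∀ P : X → Prop, (∀ᵐ x ∂μ, P x) → ∀ x, P x := by
    intro P hP x
    by_contra hx
    have : μ {x} ≤ μ {y | ¬ P y} := measure_mono (by simpa using hx)
    rw [ae_iff.1 hP] at this
    exact absurd (hμ x).1 (not_lt.2 this)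
  refine ⟨indicatorConstLp 2 (hmeas {x}) (hμ x).2.ne (1 : ℂ), fun p => ?_⟩
  rw [enorm_C_pow hmeas φ μ hμ C hC]
  have : ∀ y, (indicatorConstLp 2 (hmeas {x}) (hμ x).2.ne (1 : ℂ) : Lp ℂ 2 μ) y
      = ({x} : Set X).indicator (fun _ => (1 : ℂ)) y := hae _ indicatorConstLp_coeFn
  rw [tsum_eq_single x]
  · simp [this]
  · intro y hy; simp [this, hy]

/-- The finiteness of preimage measures and the pointwise criterion. -/
lemma crit (hmeas : ∀ s : Set X, MeasurableSet s) (φ : X → X) (μ : Measure X)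
    (hμ : ∀ x : X, 0 < μ {x} ∧ μ {x} < ⊤)
    (C : Lp ℂ 2 μ →L[ℂ] Lp ℂ 2 μ)
    (hC : ∀ f : Lp ℂ 2 μ, (C f : X → ℂ) =ᵐ[μ] fun x => f (φ x)) (m : ℕ) :
    (∀ x p, μ ((φ^[p]) ⁻¹' {x}) ≠ ⊤) ∧
    (BmOp m C = 0 → ∀ x n, altSum m (fun p => (μ ((φ^[n + p]) ⁻¹' {x})).toReal) = 0) ∧
    ((∀ x, altSum m (fun p => (μ ((φ^[p]) ⁻¹' {x})).toReal) = 0) → BmOp m C = 0) := by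
  refine ⟨fun x p => ?_, fun h x n => ?_, fun h => ?_⟩
  · obtain ⟨f, hf⟩ := norm_C_pow_single hmeas φ μ hμ C hC x
    rw [← hf]; simp
  · obtain ⟨f, hf⟩ := norm_C_pow_single hmeas φ μ hμ C hC x
    have := (BmOp_zero_iff m C).1 h ((C ^ n) f)
    rw [← this]
    congr 1
    funext p
    rw [← hf, add_comm, pow_add, ContinuousLinearMap.mul_apply]
    simp
  · rw [BmOp_zero_iff]
    intro f
    have h1 : HasSum (fun x => ∑ p ∈ Finset.range (m + 1), (-1 : ℝ) ^ p * (m.choose p : ℝ) *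
        (‖f x‖ ^ 2 * (μ ((φ^[p]) ⁻¹' {x})).toReal)) (altSum m (fun p => ‖(C ^ p) f‖ ^ 2)) :=
      hasSum_sum fun p _ => (norm_C_pow hmeas φ μ hμ C hC p f).mul_left _
    have h2 : ∀ x, ∑ p ∈ Finset.range (m + 1), (-1 : ℝ) ^ p * (m.choose p : ℝ) *
        (‖f x‖ ^ 2 * (μ ((φ^[p]) ⁻¹' {x})).toReal) = 0 := by
      intro x
      have := h x
      rw [altSum] at this
      rw [← mul_zero (‖f x‖ ^ 2), ← this, Finset.mul_sum]
      exact Finset.sum_congr rfl fun p _ => by ring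
    simp only [h2] at h1
    exact h1.unique hasSum_zero
end meas

theorem stmt11
    (κ : ℕ) (hκ : 1 ≤ κ)
    (Φ₂ : ℤ → ℕ)
    (hΦ₂ : ∀ q : ℤ, (1 ≤ Φ₂ q ∧ Φ₂ q ≤ κ) ∧ (κ : ℤ) ∣ q - (Φ₂ q : ℤ))
    (X : Type*) [MeasurableSpace X] [Countable X]
    (hmeas : ∀ s : Set X, MeasurableSet s)
    (η : ℕ → ℕ∞)
    (hη : ∃ r : ℕ, 1 ≤ r ∧ r ≤ κ ∧ η r ≠ 0)
    (xc : ℕ → X) (xb : ℕ → ℕ → ℕ → X)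
    (hinj₁ : ∀ r r' : ℕ, 1 ≤ r → r ≤ κ → 1 ≤ r' → r' ≤ κ → xc r = xc r' → r = r')
    (hinj₂ : ∀ r r' i j : ℕ, 1 ≤ r → r ≤ κ → 1 ≤ r' → r' ≤ κ → 1 ≤ i → (i : ℕ∞) ≤ η r' →
      1 ≤ j → xc r ≠ xb r' i j)
    (hinj₃ : ∀ r i j r' i' j' : ℕ, 1 ≤ r → r ≤ κ → 1 ≤ i → (i : ℕ∞) ≤ η r → 1 ≤ j →
      1 ≤ r' → r' ≤ κ → 1 ≤ i' → (i' : ℕ∞) ≤ η r' → 1 ≤ j' →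
      xb r i j = xb r' i' j' → r = r' ∧ i = i' ∧ j = j')
    (hsurj : ∀ x : X, (∃ r : ℕ, 1 ≤ r ∧ r ≤ κ ∧ x = xc r) ∨
      ∃ r i j : ℕ, 1 ≤ r ∧ r ≤ κ ∧ 1 ≤ i ∧ (i : ℕ∞) ≤ η r ∧ 1 ≤ j ∧ x = xb r i j)
    (φ : X → X)
    (hφ₁ : ∀ r i j : ℕ, 1 ≤ r → r ≤ κ → 1 ≤ i → (i : ℕ∞) ≤ η r → 1 ≤ j →
      φ (xb r i (j + 1)) = xb r i j)
    (hφ₂ : ∀ r i : ℕ, 1 ≤ r → r ≤ κ → 1 ≤ i → (i : ℕ∞) ≤ η r → φ (xb r i 1) = xc r)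
    (hφ₃ : ∀ r : ℕ, 1 ≤ r → r ≤ κ → φ (xc (Φ₂ ((r : ℤ) + 1))) = xc r)
    (μ : Measure X) [SigmaFinite μ]
    (hμ : ∀ x : X, 0 < μ {x} ∧ μ {x} < ⊤)
    (C : Lp ℂ 2 μ →L[ℂ] Lp ℂ 2 μ)
    (hC : ∀ f : Lp ℂ 2 μ, (C f : X → ℂ) =ᵐ[μ] fun x => f (φ x))
    (m : ℕ) (hm : 2 ≤ m)
    (hη₀ : ∀ i : ℕ, 1 ≤ i → i ≤ κ - 1 → η i = 0) :
    BmOp m C = 0 ↔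
      ((∀ i : ℕ, 1 ≤ i → (i : ℕ∞) ≤ η κ →
          IsPolySeq (m - 2) (fun j => (μ {xb κ i (j + 1)}).toReal)) ∧
        ∀ r : ℕ, 1 ≤ r → r ≤ κ →
          ∑ p ∈ Finset.range (m + 1),
            (-1 : ℝ) ^ p * (m.choose p : ℝ) * hRN μ φ p (xc r) = 0) := by
  obtain ⟨hfin, hcr1, hcr2⟩ := crit hmeas φ μ hμ C hC m
  have hΦ : ∀ s r : ℕ, 1 ≤ r → r ≤ κ → ((κ : ℤ) ∣ ((s : ℤ) + 1) - r) → Φ₂ ((s : ℤ) + 1) = r := by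
    intro s r h1 h2 h3
    obtain ⟨⟨h4, h5⟩, h6⟩ := hΦ₂ ((s : ℤ) + 1)
    have h7 : (κ : ℤ) ∣ (r : ℤ) - (Φ₂ ((s : ℤ) + 1) : ℤ) := by
      have := dvd_sub h6 h3
      have e : ((s : ℤ) + 1 - (Φ₂ ((s : ℤ) + 1) : ℤ)) - ((s : ℤ) + 1 - r)
        = (r : ℤ) - (Φ₂ ((s : ℤ) + 1) : ℤ) := by ring
      rwa [e] at this
    have h8 := Int.eq_zero_of_abs_lt_dvd h7 (by rw [abs_lt]; constructor <;> omega)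
    omega
  have hφ1 : φ (xc 1) = xc κ := by
    have := hφ₃ κ hκ le_rfl
    rwa [hΦ κ 1 le_rfl hκ (by simp)] at this
  have hφs : ∀ r, 1 ≤ r → r + 1 ≤ κ → φ (xc (r + 1)) = xc r := by
    intro r h1 h2
    have := hφ₃ r h1 (by omega)
    rwa [hΦ r (r + 1) (by omega) h2 (by push_cast; simp)] at this
  have hit : ∀ r, 1 ≤ r → r ≤ κ → φ^[r] (xc r) = xc κ := by
    intro r h1
    induction r, h1 using Nat.le_induction with
    | base => intro _; simpa using hφ1
    | succ r hr ih =>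
      intro h
      rw [Function.iterate_succ_apply, hφs r hr h]
      exact ih (by omega)
  have hcirc : ∀ r, 1 ≤ r → r ≤ κ → ∃ s, 1 ≤ s ∧ s ≤ κ ∧ φ (xc r) = xc s := by
    intro r h1 h2
    rcases Nat.eq_or_lt_of_le h1 with h | h
    · subst h; exact ⟨κ, hκ, le_rfl, hφ1⟩
    · obtain ⟨s, rfl⟩ := Nat.exists_eq_add_of_le' h1
      exact ⟨s, by omega, by omega, hφs s (by omega) h2⟩
  have hrk : ∀ r i : ℕ, 1 ≤ r → r ≤ κ → 1 ≤ i → (i : ℕ∞) ≤ η r → r = κ := by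
    intro r i h1 h2 h3 h4
    by_contra hne
    rw [hη₀ r h1 (by omega)] at h4
    have : i = 0 := by simpa using h4
    omega
  have hpre1 : ∀ i j : ℕ, 1 ≤ i → (i : ℕ∞) ≤ η κ → 1 ≤ j → ∀ y, φ y = xb κ i j →
      y = xb κ i (j + 1) := by
    intro i j hi hiη hj y hy
    rcases hsurj y with ⟨r, h1, h2, rfl⟩ | ⟨r, i', j', h1, h2, h3, h4, h5, rfl⟩
    · obtain ⟨s, hs1, hs2, hs⟩ := hcirc r h1 h2
      exact absurd (hs.symm.trans hy) (hinj₂ s κ i j hs1 hs2 hκ le_rfl hi hiη hj)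
    · obtain rfl := hrk r i' h1 h2 h3 h4
      rcases Nat.eq_or_lt_of_le h5 with h | h
      · subst h
        rw [hφ₂ r i' h1 h2 h3 h4] at hy
        exact absurd hy (hinj₂ r r i j hκ le_rfl hκ le_rfl hi hiη hj)
      · obtain ⟨s, rfl⟩ := Nat.exists_eq_add_of_le' h5
        rw [hφ₁ r i' s h1 h2 h3 h4 (by omega)] at hy
        obtain ⟨-, rfl, rfl⟩ := hinj₃ r i' s r i j h1 h2 h3 h4 (by omega) hκ le_rfl hi hiη hj hy
        rfl
  have hfwd : ∀ i j p : ℕ, 1 ≤ i → (i : ℕ∞) ≤ η κ → 1 ≤ j →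
      φ^[p] (xb κ i (j + p)) = xb κ i j := by
    intro i j p hi hiη hj
    induction p with
    | zero => rfl
    | succ p ih =>
      rw [Function.iterate_succ_apply, ← add_assoc, hφ₁ κ i (j + p) hκ le_rfl hi hiη (by omega), ih]
  have hpre : ∀ i j p : ℕ, 1 ≤ i → (i : ℕ∞) ≤ η κ → 1 ≤ j →
      (φ^[p]) ⁻¹' {xb κ i j} = {xb κ i (j + p)} := by
    intro i j p hi hiη hj
    ext y
    simp only [Set.mem_preimage, Set.mem_singleton_iff]
    constructor
    · induction p generalizing y with
      | zero => exact id
      | succ p ih =>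
        intro h
        rw [Function.iterate_succ_apply] at h
        exact hpre1 i (j + p) hi hiη (by omega) y (ih _ h)
    · rintro rfl; exact hfwd i j p hi hiη hj
  have hpos : ∀ x, 0 < (μ {x}).toReal := fun x => ENNReal.toReal_pos (hμ x).1.ne' (hμ x).2.ne
  have hb : ∀ r : ℕ, ∑ p ∈ Finset.range (m + 1),
      (-1 : ℝ) ^ p * (m.choose p : ℝ) * hRN μ φ p (xc r)
      = altSum m (fun p => (μ ((φ^[p]) ⁻¹' {xc r})).toReal) / (μ {xc r}).toReal := by
    intro r
    rw [altSum, Finset.sum_div]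
    exact Finset.sum_congr rfl fun p _ => by rw [hRN, mul_div_assoc]
  constructor
  · intro hB
    have hA := hcr1 hB
    refine ⟨fun i hi hiη => ?_, fun r _ _ => ?_⟩
    · have hg : IsPolySeq (m - 1) (fun j => (μ {xb κ i (j + 1)}).toReal) := by
        refine poly_of_altSum m (by omega) _ fun n => ?_
        rw [← hA (xb κ i 1) n]
        congr 1
        funext p
        rw [hpre i 1 (n + p) hi hiη le_rfl, add_comm 1]
      have ha : IsPolySeq (m - 1) (fun p => (μ ((φ^[p]) ⁻¹' {xc κ})).toReal) :=
        poly_of_altSum m (by omega) _ fun n => hA (xc κ) n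
      refine poly_bound m κ hm hκ _ _ ha hg (fun n => hpos _) fun p => ?_
      have e : p + (κ - 1) + 1 = κ + p := by omega
      simp only [e]
      rw [← ENNReal.toReal_add (hfin _ _) (hμ _).2.ne]
      refine ENNReal.toReal_mono (hfin _ _) ?_
      rw [← measure_union _ (hmeas _)]
      · refine measure_mono ?_
        rintro y (hy | hy)
        · simp only [Set.mem_preimage, Set.mem_singleton_iff] at hy ⊢
          rw [add_comm, Function.iterate_add_apply, hy, hit κ hκ le_rfl]
        · simp only [Set.mem_preimage, Set.mem_singleton_iff] at hy ⊢
          subst hy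
          rw [add_comm p κ]
          have h1 := hfwd i 1 (κ + p - 1) hi hiη le_rfl
          rw [show 1 + (κ + p - 1) = κ + p by omega] at h1
          rw [show κ + p = (κ + p - 1) + 1 by omega, Function.iterate_succ_apply']
          rw [show (κ + p - 1) + 1 = κ + p by omega, h1, hφ₂ κ i hκ le_rfl hi hiη]
      · rw [Set.disjoint_singleton_right]
        intro hy
        simp only [Set.mem_preimage, Set.mem_singleton_iff] at hy
        rw [hfwd i κ p hi hiη hκ] at hy
        exact hinj₂ κ κ i κ hκ le_rfl hκ le_rfl hi hiη hκ hy.symm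
    · rw [hb]
      have := hA (xc r) 0
      simp only [zero_add] at this
      rw [this, zero_div]
  · rintro ⟨h1, h2⟩
    refine hcr2 fun x => ?_
    rcases hsurj x with ⟨r, hr1, hr2, rfl⟩ | ⟨r, i, j, hr1, hr2, h3, h4, h5, rfl⟩
    · have := h2 r hr1 hr2
      rw [hb, div_eq_zero_iff] at this
      exact this.resolve_right (hpos _).ne'
    · obtain rfl := hrk r i hr1 hr2 h3 h4
      have := altSum_of_poly m (m - 2) (by omega) _ (h1 i h3 h4) (j - 1)
      rw [← this]
      congr 1
      funext p
      rw [hpre i j p h3 h4 h5, show j - 1 + p + 1 = j + p by omega]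
end
end

section
/- Let m ≥ 2 and k ≥ 0 be integers and suppose π(x) = 1 for every x ∈ X. Then the weighted composition operator W on L²(μ) is k-quasi-m-isometric if and only if both of the following hold: (a) for every r ∈ J_κ and i ∈ J_{η_r} the sequence (μ({x^r_{i,k+j+1}}))_{j∈ℤ₊} is a polynomial in j of degree at most m−2; (b) ∑_{p=0}^{m} (−1)^p binom(m,p) h_{p+k}(x_r) = 0 for every r ∈ J_κ. -/
open MeasureTheory Finset

noncomputable section

open fwdDiff in
theorem aux_alt (a : ℕ → ℝ) (m n : ℕ) :
    ∑ p ∈ Finset.range (m + 1), (-1 : ℝ) ^ p * (m.choose p : ℝ) * a (n + p)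
      = (-1) ^ m * ((fwdDiff 1)^[m] a n) := by
  rw [fwdDiff_iter_eq_sum_shift, Finset.mul_sum]
  refine Finset.sum_congr rfl fun p hp => ?_
  have hp' : p ≤ m := by simpa [Nat.lt_succ_iff] using hp
  obtain ⟨q, rfl⟩ := Nat.exists_eq_add_of_le hp'
  simp only [zsmul_eq_mul, smul_eq_mul, mul_one]
  push_cast
  rw [Nat.add_sub_cancel_left, pow_add]
  have : (-1 : ℝ) ^ q * (-1) ^ q = 1 := by rw [← mul_pow]; simp
  linear_combination (-(-1 : ℝ) ^ p * ((p + q).choose p : ℝ) * a (n + p)) * this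

theorem aux_poly_of_alt (a : ℕ → ℝ) (m : ℕ) (hm : 1 ≤ m)
    (h : ∀ n, ∑ p ∈ Finset.range (m + 1), (-1 : ℝ) ^ p * (m.choose p : ℝ) * a (n + p) = 0) :
    IsPolySeq (m - 1) a := by
  have h0 : (fwdDiff 1)^[m] a = 0 := by
    funext n
    have := h n
    rw [aux_alt] at this
    simpa using this
  have h1 : ∀ l, m ≤ l → (fwdDiff 1)^[l] a 0 = 0 := by
    intro l hl
    obtain ⟨c, rfl⟩ := Nat.exists_eq_add_of_le hl
    rw [add_comm, Function.iterate_add_apply, h0, fwdDiff_iter_eq_sum_shift]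
    simp
  refine ⟨∑ l ∈ Finset.range m, Polynomial.C ((fwdDiff 1)^[l] a 0 / (l.factorial : ℝ)) *
    descPochhammer ℝ l, ?_, ?_⟩
  · refine Polynomial.natDegree_sum_le_of_forall_le _ _ fun l hl => ?_
    refine (Polynomial.natDegree_C_mul_le _ _).trans ?_
    rw [descPochhammer_natDegree]
    have := Finset.mem_range.1 hl
    omega
  · intro n
    have h2 := shift_eq_sum_fwdDiff_iter (1 : ℕ) a n 0
    simp only [smul_eq_mul, mul_one, zero_add, nsmul_eq_mul] at h2
    rw [h2, Polynomial.eval_finset_sum]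
    have h3 : ∀ l : ℕ, Polynomial.eval (n : ℝ) (Polynomial.C ((fwdDiff 1)^[l] a 0 /
        (l.factorial : ℝ)) * descPochhammer ℝ l) = (n.choose l : ℝ) * (fwdDiff 1)^[l] a 0 := by
      intro l
      rw [Polynomial.eval_mul, Polynomial.eval_C, descPochhammer_eval_eq_descFactorial,
        Nat.descFactorial_eq_factorial_mul_choose]
      have : (l.factorial : ℝ) ≠ 0 := by exact_mod_cast Nat.factorial_ne_zero l
      push_cast
      field_simp
    simp only [h3]
    have e1 : ∑ l ∈ Finset.range m, (n.choose l : ℝ) * (fwdDiff 1)^[l] a 0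
        = ∑ l ∈ Finset.range (m + (n + 1)), (n.choose l : ℝ) * (fwdDiff 1)^[l] a 0 := by
      refine Finset.sum_subset (by intro x; simp; omega) fun l _ hl => ?_
      rw [h1 l (by simpa using hl), mul_zero]
    have e2 : ∑ l ∈ Finset.range (n + 1), (n.choose l : ℝ) * (fwdDiff 1)^[l] a 0
        = ∑ l ∈ Finset.range (m + (n + 1)), (n.choose l : ℝ) * (fwdDiff 1)^[l] a 0 := by
      refine Finset.sum_subset (by intro x; simp; omega) fun l _ hl => ?_
      have : n < l := by simp at hl; omega
      rw [Nat.choose_eq_zero_of_lt this]; simp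
    rw [e1, e2]

theorem aux_alt_of_poly (a : ℕ → ℝ) (m d : ℕ) (hd : d < m) (h : IsPolySeq d a) (n : ℕ) :
    ∑ p ∈ Finset.range (m + 1), (-1 : ℝ) ^ p * (m.choose p : ℝ) * a (n + p) = 0 := by
  obtain ⟨q, hq, hqa⟩ := h
  have h1 := congrFun (Polynomial.fwdDiff_iter_eq_zero_of_degree_lt (hq.trans_lt hd)) (n : ℝ)
  rw [aux_alt]
  rw [fwdDiff_iter_eq_sum_shift] at h1 ⊢
  simp only [← hqa]
  simp only [smul_eq_mul, mul_one, nsmul_eq_mul, Pi.zero_apply] at h1 ⊢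
  push_cast
  rw [h1, mul_zero]

theorem aux_degree (P Q : Polynomial ℝ) (m c : ℕ) (hm : 2 ≤ m) (hP : P.natDegree ≤ m - 1)
    (hpos : ∀ n : ℕ, 0 < Q.eval (n : ℝ))
    (hle : ∀ n : ℕ, Q.eval ((n + c : ℕ) : ℝ) ≤ P.eval ((n + (c + 1) : ℕ) : ℝ) - P.eval (n : ℝ)) :
    Q.natDegree ≤ m - 2 := by
  by_contra hcon
  push Not at hcon
  set Q' := Polynomial.taylor (c : ℝ) Q with hQ'
  set P' := Polynomial.taylor ((c + 1 : ℕ) : ℝ) P with hP'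
  have hQd : Q'.natDegree = Q.natDegree := Polynomial.natDegree_taylor _ _
  have hPd : P'.natDegree = P.natDegree := Polynomial.natDegree_taylor _ _
  have hD : (P' - P).natDegree ≤ m - 2 := by
    rw [Polynomial.natDegree_le_iff_coeff_eq_zero]
    intro N hN
    rw [Polynomial.coeff_sub]
    rcases lt_or_ge P.natDegree N with h | h
    · rw [Polynomial.coeff_eq_zero_of_natDegree_lt h,
        Polynomial.coeff_eq_zero_of_natDegree_lt (hPd ▸ h), sub_zero]
    · have hN' : N = P.natDegree := by omega
      have h2 : P'.leadingCoeff = P.leadingCoeff := Polynomial.leadingCoeff_taylor _ _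
      rw [Polynomial.leadingCoeff, Polynomial.leadingCoeff, hPd] at h2
      rw [hN', h2, sub_self]
  have hdeg : (P' - P).degree < Q'.degree := by
    apply Polynomial.degree_lt_degree
    omega
  have ht := (Polynomial.div_tendsto_zero_of_degree_lt (P' - P) Q' hdeg).comp
    (tendsto_natCast_atTop_atTop (R := ℝ))
  have h1 : ∀ n : ℕ, (1 : ℝ) ≤ Polynomial.eval (n : ℝ) (P' - P) / Polynomial.eval (n : ℝ) Q' := by
    intro n
    have e1 : Polynomial.eval (n : ℝ) Q' = Q.eval ((n + c : ℕ) : ℝ) := by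
      rw [hQ', Polynomial.taylor_eval]; push_cast; ring_nf
    have e2 : Polynomial.eval (n : ℝ) P' = P.eval ((n + (c + 1) : ℕ) : ℝ) := by
      rw [hP', Polynomial.taylor_eval]; push_cast; ring_nf
    rw [Polynomial.eval_sub, e1, e2, one_le_div (hpos _)]
    exact hle n
  have := ge_of_tendsto' ht h1
  linarith

theorem aux_ae {X : Type*} [MeasurableSpace X] {μ : Measure X} (hμ : ∀ x : X, 0 < μ {x})
    {p : X → Prop} (h : ∀ᵐ x ∂μ, p x) (x : X) : p x := by
  by_contra hx
  have : μ {x} = 0 := measure_mono_null (by simpa using hx) h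
  exact (hμ x).ne' this

theorem aux_pow {X : Type*} [MeasurableSpace X] {μ : Measure X} (hμ : ∀ x : X, 0 < μ {x})
    (φ : X → X) (W : Lp ℂ 2 μ →L[ℂ] Lp ℂ 2 μ)
    (hW : ∀ (f : Lp ℂ 2 μ) x, (W f : X → ℂ) x = f (φ x)) (p : ℕ) :
    ∀ (f : Lp ℂ 2 μ) x, ((W ^ p) f : X → ℂ) x = f (φ^[p] x) := by
  induction p with
  | zero => intro f x; simp
  | succ p ih =>
    intro f x
    rw [pow_succ, ContinuousLinearMap.mul_apply, ih, hW, Function.iterate_succ_apply']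

theorem aux_fin {X : Type*} [MeasurableSpace X] (hmeas : ∀ s : Set X, MeasurableSet s)
    {μ : Measure X} (hμ : ∀ x : X, 0 < μ {x} ∧ μ {x} < ⊤)
    (φ : X → X) (W : Lp ℂ 2 μ →L[ℂ] Lp ℂ 2 μ)
    (hW : ∀ (f : Lp ℂ 2 μ) x, (W f : X → ℂ) x = f (φ x)) (p : ℕ) (y : X) :
    μ (φ^[p] ⁻¹' {y}) < ⊤ := by
  set e : Lp ℂ 2 μ := indicatorConstLp 2 (hmeas {y}) (hμ y).2.ne (1 : ℂ) with he
  have he' : ∀ x, e x = ({y} : Set X).indicator (fun _ => (1 : ℂ)) x :=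
    aux_ae (fun x => (hμ x).1) indicatorConstLp_coeFn
  have h := Lp.memLp ((W ^ p) e)
  have h2 : (((W ^ p) e : Lp ℂ 2 μ) : X → ℂ)
      = (φ^[p] ⁻¹' {y}).indicator (fun _ => (1 : ℂ)) := by
    funext x
    rw [aux_pow (fun x => (hμ x).1) φ W hW, he']
    rfl
  rw [h2, memLp_indicator_iff_restrict (hmeas _)] at h
  have := (memLp_const_iff (by norm_num) (by norm_num)).1 h
  simpa using this

theorem aux_inner {X : Type*} [MeasurableSpace X] (hmeas : ∀ s : Set X, MeasurableSet s)
    {μ : Measure X} (hμ : ∀ x : X, 0 < μ {x} ∧ μ {x} < ⊤)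
    (φ : X → X) (W : Lp ℂ 2 μ →L[ℂ] Lp ℂ 2 μ)
    (hW : ∀ (f : Lp ℂ 2 μ) x, (W f : X → ℂ) x = f (φ x)) (p : ℕ) (y : X) (f : Lp ℂ 2 μ) :
    inner ℂ ((W ^ p) (indicatorConstLp 2 (hmeas {y}) (hμ y).2.ne (1 : ℂ))) ((W ^ p) f)
      = ((μ (φ^[p] ⁻¹' {y})).toReal : ℂ) * f y := by
  set e : Lp ℂ 2 μ := indicatorConstLp 2 (hmeas {y}) (hμ y).2.ne (1 : ℂ) with he
  have he' : ∀ x, e x = ({y} : Set X).indicator (fun _ => (1 : ℂ)) x :=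
    aux_ae (fun x => (hμ x).1) indicatorConstLp_coeFn
  rw [L2.inner_def]
  have h2 : (fun x => inner ℂ (((W ^ p) e : Lp ℂ 2 μ) x) (((W ^ p) f : Lp ℂ 2 μ) x))
      = (φ^[p] ⁻¹' {y}).indicator (fun _ => f y) := by
    funext x
    rw [aux_pow (fun x => (hμ x).1) φ W hW, aux_pow (fun x => (hμ x).1) φ W hW, he']
    by_cases hx : φ^[p] x = y
    · simp [hx]
    · simp [hx]
  rw [h2, integral_indicator_const _ (hmeas _)]
  simp [Measure.real]

theorem aux_op {H : Type*} [NormedAddCommGroup H] [InnerProductSpace ℂ H] [CompleteSpace H]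
    (m K : ℕ) (T : H →L[ℂ] H) (f g : H) :
    inner ℂ f (((ContinuousLinearMap.adjoint T) ^ K * BmOp m T * T ^ K) g)
      = (-1) ^ m * ∑ p ∈ Finset.range (m + 1), (-1 : ℂ) ^ p * (m.choose p : ℂ) *
        inner ℂ ((T ^ (p + K)) f) ((T ^ (p + K)) g) := by
  have hadj : ∀ (n : ℕ) (u v : H), inner ℂ u (((ContinuousLinearMap.adjoint T) ^ n) v)
      = inner ℂ ((T ^ n) u) v := by
    intro n u v
    rw [← ContinuousLinearMap.star_eq_adjoint, ← star_pow, ContinuousLinearMap.star_eq_adjoint,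
      ContinuousLinearMap.adjoint_inner_right]
  rw [ContinuousLinearMap.mul_apply, ContinuousLinearMap.mul_apply, hadj, BmOp,
    ContinuousLinearMap.sum_apply, inner_sum, Finset.mul_sum, ← Finset.sum_range_reflect]
  refine Finset.sum_congr rfl fun p hp => ?_
  have hp' : p ≤ m := by simpa [Nat.lt_succ_iff] using hp
  obtain ⟨q, rfl⟩ := Nat.exists_eq_add_of_le hp'
  have e1 : p + q + 1 - 1 - p = q := by omega
  have e2 : p + q - q = p := by omega
  rw [e1, e2, ContinuousLinearMap.smul_apply, inner_smul_right, ContinuousLinearMap.mul_apply,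
    hadj, ← ContinuousLinearMap.mul_apply, ← ContinuousLinearMap.mul_apply, ← pow_add,
    Nat.choose_symm_add, pow_add (-1 : ℂ)]
  have : (-1 : ℂ) ^ p * (-1) ^ p = 1 := by rw [← mul_pow]; simp
  linear_combination (-(-1 : ℂ) ^ q * ((p + q).choose q : ℂ) *
    inner ℂ ((T ^ (p + K)) f) ((T ^ (p + K)) g)) * this

theorem aux_shift {H : Type*} [NormedAddCommGroup H] [InnerProductSpace ℂ H] [CompleteSpace H]
    (m k n : ℕ) (T : H →L[ℂ] H) (h : IsQuasiIso k m T) : IsQuasiIso (k + n) m T := by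
  unfold IsQuasiIso at *
  rw [pow_add T, add_comm, pow_add]
  have : (ContinuousLinearMap.adjoint T) ^ n * (ContinuousLinearMap.adjoint T) ^ k * BmOp m T *
      (T ^ k * T ^ n) = (ContinuousLinearMap.adjoint T) ^ n *
      ((ContinuousLinearMap.adjoint T) ^ k * BmOp m T * T ^ k) * T ^ n := by
    simp only [mul_assoc]
  rw [this, h, mul_zero, zero_mul]

theorem aux_quasi {X : Type*} [MeasurableSpace X] (hmeas : ∀ s : Set X, MeasurableSet s)
    {μ : Measure X} (hμ : ∀ x : X, 0 < μ {x} ∧ μ {x} < ⊤)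
    (φ : X → X) (W : Lp ℂ 2 μ →L[ℂ] Lp ℂ 2 μ)
    (hW : ∀ (f : Lp ℂ 2 μ) x, (W f : X → ℂ) x = f (φ x)) (m K : ℕ) :
    IsQuasiIso K m W ↔ ∀ y : X, ∑ p ∈ Finset.range (m + 1), (-1 : ℝ) ^ p * (m.choose p : ℝ) *
      (μ (φ^[p + K] ⁻¹' {y})).toReal = 0 := by
  have key : ∀ (y : X) (f : Lp ℂ 2 μ),
      inner ℂ (indicatorConstLp 2 (hmeas {y}) (hμ y).2.ne (1 : ℂ))
        (((ContinuousLinearMap.adjoint W) ^ K * BmOp m W * W ^ K) f)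
      = (-1) ^ m * f y * ((∑ p ∈ Finset.range (m + 1), (-1 : ℝ) ^ p * (m.choose p : ℝ) *
      (μ (φ^[p + K] ⁻¹' {y})).toReal : ℝ) : ℂ) := by
    intro y f
    rw [aux_op, mul_assoc]
    congr 1
    rw [Complex.ofReal_sum, Finset.mul_sum]
    refine Finset.sum_congr rfl fun p _ => ?_
    rw [aux_inner hmeas hμ φ W hW]
    push_cast
    ring
  constructor
  · intro h y
    have h1 := key y (indicatorConstLp 2 (hmeas {y}) (hμ y).2.ne (1 : ℂ))
    rw [h, aux_ae (fun x => (hμ x).1) indicatorConstLp_coeFn y] at h1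
    simp only [ContinuousLinearMap.zero_apply, inner_zero_right, Set.indicator_of_mem,
      Set.mem_singleton_iff, mul_one] at h1
    have h2 := mul_eq_zero.1 h1.symm
    rcases h2 with h2 | h2
    · simp at h2
    · exact_mod_cast h2
  · intro h
    haveI : MeasurableSingletonClass X := ⟨fun x => hmeas _⟩
    refine ContinuousLinearMap.ext fun f => ?_
    refine Lp.ext (Filter.Eventually.of_forall fun y => ?_)
    have h1 := key y f
    rw [h y, L2.inner_indicatorConstLp_one, integral_singleton] at h1
    have h3 : ((0 : Lp ℂ 2 μ →L[ℂ] Lp ℂ 2 μ) f : X → ℂ) y = 0 := by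
      rw [ContinuousLinearMap.zero_apply]
      exact aux_ae (fun x => (hμ x).1) (Lp.coeFn_zero ℂ 2 μ) y
    rw [h3]
    have h4 : μ.real {y} ≠ 0 := (ENNReal.toReal_pos (hμ y).1.ne' (hμ y).2.ne).ne'
    simpa [h4] using h1

theorem stmt16
    (κ : ℕ) (hκ : 1 ≤ κ)
    (Φ₂ : ℤ → ℕ)
    (hΦ₂ : ∀ q : ℤ, (1 ≤ Φ₂ q ∧ Φ₂ q ≤ κ) ∧ (κ : ℤ) ∣ q - (Φ₂ q : ℤ))
    (X : Type*) [MeasurableSpace X] [Countable X]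
    (hmeas : ∀ s : Set X, MeasurableSet s)
    (η : ℕ → ℕ∞)
    (hη : ∃ r : ℕ, 1 ≤ r ∧ r ≤ κ ∧ η r ≠ 0)
    (xc : ℕ → X) (xb : ℕ → ℕ → ℕ → X)
    (hinj₁ : ∀ r r' : ℕ, 1 ≤ r → r ≤ κ → 1 ≤ r' → r' ≤ κ → xc r = xc r' → r = r')
    (hinj₂ : ∀ r r' i j : ℕ, 1 ≤ r → r ≤ κ → 1 ≤ r' → r' ≤ κ → 1 ≤ i → (i : ℕ∞) ≤ η r' →
      1 ≤ j → xc r ≠ xb r' i j)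
    (hinj₃ : ∀ r i j r' i' j' : ℕ, 1 ≤ r → r ≤ κ → 1 ≤ i → (i : ℕ∞) ≤ η r → 1 ≤ j →
      1 ≤ r' → r' ≤ κ → 1 ≤ i' → (i' : ℕ∞) ≤ η r' → 1 ≤ j' →
      xb r i j = xb r' i' j' → r = r' ∧ i = i' ∧ j = j')
    (hsurj : ∀ x : X, (∃ r : ℕ, 1 ≤ r ∧ r ≤ κ ∧ x = xc r) ∨
      ∃ r i j : ℕ, 1 ≤ r ∧ r ≤ κ ∧ 1 ≤ i ∧ (i : ℕ∞) ≤ η r ∧ 1 ≤ j ∧ x = xb r i j)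
    (φ : X → X)
    (hφ₁ : ∀ r i j : ℕ, 1 ≤ r → r ≤ κ → 1 ≤ i → (i : ℕ∞) ≤ η r → 1 ≤ j →
      φ (xb r i (j + 1)) = xb r i j)
    (hφ₂ : ∀ r i : ℕ, 1 ≤ r → r ≤ κ → 1 ≤ i → (i : ℕ∞) ≤ η r → φ (xb r i 1) = xc r)
    (hφ₃ : ∀ r : ℕ, 1 ≤ r → r ≤ κ → φ (xc (Φ₂ ((r : ℤ) + 1))) = xc r)
    (μ : Measure X) [SigmaFinite μ]
    (hμ : ∀ x : X, 0 < μ {x} ∧ μ {x} < ⊤)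
    (π : X → ℝ) (hπ : ∃ B : ℝ, ∀ x : X, |π x| ≤ B)
    (W : Lp ℂ 2 μ →L[ℂ] Lp ℂ 2 μ)
    (hW : ∀ f : Lp ℂ 2 μ, (W f : X → ℂ) =ᵐ[μ] fun x => (π x : ℂ) * f (φ x))
    (m k : ℕ) (hm : 2 ≤ m) (hπ₁ : ∀ x : X, π x = 1) :
    IsQuasiIso k m W ↔
      ((∀ r i : ℕ, 1 ≤ r → r ≤ κ → 1 ≤ i → (i : ℕ∞) ≤ η r →
          IsPolySeq (m - 2) (fun j => (μ {xb r i (k + j + 1)}).toReal)) ∧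
        ∀ r : ℕ, 1 ≤ r → r ≤ κ →
          ∑ p ∈ Finset.range (m + 1),
            (-1 : ℝ) ^ p * (m.choose p : ℝ) * hRN μ φ (p + k) (xc r) = 0) := by
  have hW' : ∀ (f : Lp ℂ 2 μ) x, (W f : X → ℂ) x = f (φ x) := by
    intro f x
    have := aux_ae (fun x => (hμ x).1) (hW f) x
    simpa [hπ₁] using this
  have huniq : ∀ (q : ℤ) (s : ℕ), 1 ≤ s → s ≤ κ → (κ : ℤ) ∣ q - s → Φ₂ q = s := by
    intro q s hs1 hs2 hs3
    obtain ⟨⟨h1, h2⟩, h3⟩ := hΦ₂ q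
    have h4 : (κ : ℤ) ∣ (Φ₂ q : ℤ) - s := by
      obtain ⟨u, hu⟩ := hs3
      obtain ⟨v, hv⟩ := h3
      exact ⟨u - v, by linear_combination hu - hv⟩
    have h5 := Int.eq_zero_of_abs_lt_dvd h4 (by rw [abs_lt]; constructor <;> omega)
    omega
  have hcyc : ∀ (r : ℕ), 1 ≤ r → r ≤ κ → ∀ s : ℕ, φ^[s] (xc (Φ₂ ((r : ℤ) + s))) = xc r := by
    intro r h1 h2 s
    induction s with
    | zero =>
      rw [huniq _ r h1 h2 (by simp)]; rfl
    | succ s ih =>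
      obtain ⟨⟨g1, g2⟩, g3⟩ := hΦ₂ ((r : ℤ) + s)
      have g4 := hφ₃ _ g1 g2
      obtain ⟨⟨f1, f2⟩, f3⟩ := hΦ₂ ((Φ₂ ((r : ℤ) + s) : ℤ) + 1)
      have : Φ₂ ((r : ℤ) + (s + 1 : ℕ)) = Φ₂ ((Φ₂ ((r : ℤ) + s) : ℤ) + 1) := by
        apply huniq _ _ f1 f2
        obtain ⟨u, hu⟩ := g3
        obtain ⟨v, hv⟩ := f3
        exact ⟨u + v, by push_cast; linear_combination hu + hv⟩
      rw [Function.iterate_succ_apply, this, g4, ih]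
  have hcycκ : ∀ (r : ℕ), 1 ≤ r → r ≤ κ → φ^[κ] (xc r) = xc r := by
    intro r h1 h2
    have := hcyc r h1 h2 κ
    rwa [huniq _ r h1 h2 (by simp)] at this
  have hφc : ∀ r : ℕ, 1 ≤ r → r ≤ κ → ∃ s : ℕ, 1 ≤ s ∧ s ≤ κ ∧ φ (xc r) = xc s := by
    intro r h1 h2
    obtain ⟨⟨g1, g2⟩, g3⟩ := hΦ₂ ((r : ℤ) - 1)
    refine ⟨_, g1, g2, ?_⟩
    have := hφ₃ _ g1 g2
    rwa [huniq _ r h1 h2 (by obtain ⟨u, hu⟩ := g3; exact ⟨-u, by linear_combination -hu⟩)] at this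
  have hb : ∀ r i : ℕ, 1 ≤ r → r ≤ κ → 1 ≤ i → (i : ℕ∞) ≤ η r → ∀ p j : ℕ, 1 ≤ j →
      φ^[p] (xb r i (j + p)) = xb r i j := by
    intro r i h1 h2 h3 h4 p
    induction p with
    | zero => intro j _; rfl
    | succ p ih =>
      intro j hj
      rw [Function.iterate_succ_apply, ← add_assoc, hφ₁ r i (j + p) h1 h2 h3 h4 (by omega), ih j hj]
  have hpre1 : ∀ r i j : ℕ, 1 ≤ r → r ≤ κ → 1 ≤ i → (i : ℕ∞) ≤ η r → 1 ≤ j → ∀ y,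
      φ y = xb r i j → y = xb r i (j + 1) := by
    intro r i j h1 h2 h3 h4 h5 y hy
    rcases hsurj y with ⟨s, s1, s2, rfl⟩ | ⟨s, i', j', s1, s2, s3, s4, s5, rfl⟩
    · obtain ⟨t, t1, t2, t3⟩ := hφc s s1 s2
      exact absurd (t3.symm.trans hy) (hinj₂ _ _ _ _ t1 t2 h1 h2 h3 h4 h5)
    · obtain ⟨j'', rfl⟩ := Nat.exists_eq_add_of_le' s5
      rcases Nat.eq_zero_or_pos j'' with rfl | hj
      · rw [zero_add, hφ₂ s i' s1 s2 s3 s4] at hy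
        exact absurd hy (hinj₂ _ _ _ _ s1 s2 h1 h2 h3 h4 h5)
      · rw [hφ₁ s i' j'' s1 s2 s3 s4 hj] at hy
        obtain ⟨rfl, rfl, rfl⟩ := hinj₃ _ _ _ _ _ _ s1 s2 s3 s4 hj h1 h2 h3 h4 h5 hy
        rfl
  have hpre : ∀ r i : ℕ, 1 ≤ r → r ≤ κ → 1 ≤ i → (i : ℕ∞) ≤ η r → ∀ p j : ℕ, 1 ≤ j →
      φ^[p] ⁻¹' {xb r i j} = {xb r i (j + p)} := by
    intro r i h1 h2 h3 h4 p j hj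
    refine Set.Subset.antisymm ?_ ?_
    · induction p generalizing j with
      | zero => intro y hy; simpa using hy
      | succ p ih =>
        intro y hy
        have hy' : φ (φ^[p] y) = xb r i j := by
          rw [← Function.iterate_succ_apply' φ]; exact hy
        have := ih (j + 1) (by omega) (hpre1 r i j h1 h2 h3 h4 hj _ hy')
        rw [show j + (p + 1) = j + 1 + p by omega]; exact this
    · rintro y rfl
      exact hb r i h1 h2 h3 h4 p j hj
  have hquasi := aux_quasi hmeas hμ φ W hW' m
  have hfin := aux_fin hmeas hμ φ W hW'
  constructor
  · intro h
    constructor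
    · intro r i h1 h2 h3 h4
      have hQ : IsPolySeq (m - 1) (fun j => (μ {xb r i (k + j + 1)}).toReal) := by
        refine aux_poly_of_alt _ m (by omega) fun n => ?_
        have := (hquasi k).1 h (xb r i (n + 1))
        rw [← this]
        refine Finset.sum_congr rfl fun p _ => ?_
        rw [hpre r i h1 h2 h3 h4 _ _ (by omega)]
        rw [show n + 1 + (p + k) = k + (n + p) + 1 by omega]
      have hP : IsPolySeq (m - 1) (fun n => (μ (φ^[k + n] ⁻¹' {xc r})).toReal) := by
        refine aux_poly_of_alt _ m (by omega) fun n => ?_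
        have := (hquasi (k + n)).1 (aux_shift m k n W h) (xc r)
        rw [← this]
        refine Finset.sum_congr rfl fun p _ => ?_
        rw [show k + (n + p) = p + (k + n) by omega]
      obtain ⟨Q, hQd, hQe⟩ := hQ
      obtain ⟨P, hPd, hPe⟩ := hP
      refine ⟨Q, ?_, hQe⟩
      obtain ⟨c, hc⟩ := Nat.exists_eq_add_of_le' hκ
      refine aux_degree P Q m c hm hPd ?_ ?_
      · intro n
        rw [hQe]
        exact ENNReal.toReal_pos (hμ _).1.ne' (hμ _).2.ne
      · intro n
        rw [hQe, hPe, hPe, ← hc, le_sub_iff_add_le,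
          ← ENNReal.toReal_add (hμ _).2.ne (hfin _ _).ne]
        refine ENNReal.toReal_mono (hfin _ _).ne ?_
        have hidx : k + (n + c) + 1 = κ + (k + n) := by omega
        rw [hidx, ← measure_union _ (hmeas _)]
        · refine measure_mono (Set.union_subset ?_ ?_)
          · rintro y rfl
            have e1 := hb r i h1 h2 h3 h4 (k + (n + c)) 1 le_rfl
            have e2 : k + (n + κ) = (k + (n + c)) + 1 := by omega
            have e3 : κ + (k + n) = 1 + (k + (n + c)) := by omega
            change φ^[k + (n + κ)] _ = _
            rw [e2, e3, Function.iterate_succ_apply', e1]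
            exact hφ₂ r i h1 h2 h3 h4
          · intro y hy
            have hy' : φ^[k + n] y = xc r := hy
            change φ^[k + (n + κ)] y = xc r
            rw [show k + (n + κ) = κ + (k + n) by omega, Function.iterate_add_apply, hy',
              hcycκ r h1 h2]
        · rw [Set.disjoint_singleton_left]
          intro hy
          have hy' : φ^[k + n] (xb r i (κ + (k + n))) = xc r := hy
          rw [hb r i h1 h2 h3 h4 (k + n) κ hκ] at hy'
          exact hinj₂ r r i κ h1 h2 h1 h2 h3 h4 hκ hy'.symm
    · intro r h1 h2
      have := (hquasi k).1 h (xc r)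
      simp only [hRN, ← mul_div_assoc]
      rw [← Finset.sum_div, this, zero_div]
  · rintro ⟨ha, hb'⟩
    rw [hquasi]
    intro y
    rcases hsurj y with ⟨s, s1, s2, rfl⟩ | ⟨s, i, j, s1, s2, s3, s4, s5, rfl⟩
    · have := hb' s s1 s2
      simp only [hRN, ← mul_div_assoc] at this
      rw [← Finset.sum_div, div_eq_zero_iff] at this
      rcases this with h | h
      · exact h
      · exact absurd h (ENNReal.toReal_pos (hμ _).1.ne' (hμ _).2.ne).ne'
    · have := aux_alt_of_poly _ m (m - 2) (by omega) (ha s i s1 s2 s3 s4) (j - 1)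
      rw [← this]
      refine Finset.sum_congr rfl fun p _ => ?_
      rw [hpre s i s1 s2 s3 s4 _ _ s5, show j + (p + k) = k + (j - 1 + p) + 1 by omega]
end
end
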